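/- Second Abel-type identity: Define A(β, m) := 1 if m = 1 and A(β, m) := β·(β + log m)^{Ω(m) - 1} if m ≥ 2. Then for every positive integer n and all real numbers φ, β: (φ + β + log n)^{Ω(n)} = ∑_{d | n} (n choose d)_f · (φ + log d)^{Ω(d)} · A(β, n/d). -/

import Mathlib

open Finset ArithmeticFunction

/-- The factorization binomial coefficient
`(n choose d)_f = ∏_{p prime} C(ν_p(n), ν_p(d)) = f(n)/(f(d)·f(n/d))`,
where `f(n) = ∏_p (ν_p(n))!`. -/
def fChoose (n d : ℕ) : ℕ :=
  ∏ p ∈ n.primeFactors, Nat.choose (padicValNat p n) (padicValNat p d)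

/-- The Abel-type factor `A(β, m) = β·(β + ln m)^{Ω(m)-1}` for `m ≥ 2`,
with `A(β, 1) = 1`. -/
noncomputable def abelFactor (β : ℝ) (m : ℕ) : ℝ :=
  if m = 1 then 1 else β * (β + Real.log m) ^ (cardFactors m - 1)

theorem aux_pointwise (p m d : ℕ) (hp : p.Prime) (hm : 0 < m) (hd : d ∣ p * m) :
    fChoose (p * m) d = (if d ∣ m then fChoose m d else 0) +
      (if p ∣ d then fChoose m (d / p) else 0) := by
  have hm0 : m ≠ 0 := hm.ne'
  have hp0 : p ≠ 0 := hp.ne_zero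
  have hpm0 : p * m ≠ 0 := mul_ne_zero hp0 hm0
  have hd0 : d ≠ 0 := fun h => hpm0 (by simpa [h] using hd)
  haveI : Fact p.Prime := ⟨hp⟩
  have hpf : (p * m).primeFactors = insert p (m.primeFactors.erase p) := by
    rw [Nat.primeFactors_mul hp0 hm0, hp.primeFactors]
    ext q; simp; tauto
  set R := ∏ q ∈ m.primeFactors.erase p, Nat.choose (padicValNat q m) (padicValNat q d) with hR
  have h1 : fChoose (p * m) d = Nat.choose (padicValNat p m + 1) (padicValNat p d) * R := by
    unfold fChoose
    rw [hpf, Finset.prod_insert (by simp), padicValNat.mul hp0 hm0, padicValNat_self, add_comm 1]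
    congr 1
    apply Finset.prod_congr rfl
    intro q hq
    have hqp : q.Prime := (Nat.mem_primeFactors.1 (Finset.mem_erase.1 hq).2).1
    haveI : Fact q.Prime := ⟨hqp⟩
    rw [padicValNat.mul hp0 hm0, padicValNat_primes (Finset.mem_erase.1 hq).1, zero_add]
  have key : ∀ e, e ∣ m → fChoose m e = Nat.choose (padicValNat p m) (padicValNat p e) *
      ∏ q ∈ m.primeFactors.erase p, Nat.choose (padicValNat q m) (padicValNat q e) := by
    intro e he
    unfold fChoose
    by_cases hpm : p ∈ m.primeFactors
    · rw [Finset.mul_prod_erase m.primeFactors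
        (fun q => Nat.choose (padicValNat q m) (padicValNat q e)) hpm]
    · rw [Finset.erase_eq_of_notMem hpm]
      have hndvd : ¬ p ∣ m := fun h => hpm (Nat.mem_primeFactors.2 ⟨hp, h, hm0⟩)
      have hnd2 : ¬ p ∣ e := fun h => hndvd (h.trans he)
      rw [padicValNat.eq_zero_of_not_dvd hndvd, padicValNat.eq_zero_of_not_dvd hnd2]
      simp
  have h2 : (if d ∣ m then fChoose m d else 0) =
      Nat.choose (padicValNat p m) (padicValNat p d) * R := by
    split_ifs with h
    · exact key d h
    · have : padicValNat p m < padicValNat p d := by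
        by_contra hlt
        push Not at hlt
        apply h
        rw [← Nat.factorization_le_iff_dvd hd0 hm0]
        intro q
        by_cases hqp : q = p
        · subst hqp
          simpa [Nat.factorization_def _ hp] using hlt
        · have := (Nat.factorization_le_iff_dvd hd0 hpm0).2 hd q
          rw [Nat.factorization_mul hp0 hm0, hp.factorization] at this
          simpa [Finsupp.single_apply, Ne.symm hqp] using this
      rw [Nat.choose_eq_zero_of_lt this, zero_mul]
  rw [h1, h2]
  by_cases hpd : p ∣ d
  · obtain ⟨e, rfl⟩ := hpd
    have he0 : e ≠ 0 := fun h => hd0 (by simp [h])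
    have hem : e ∣ m := Nat.dvd_of_mul_dvd_mul_left hp.pos hd
    rw [if_pos (dvd_mul_right _ _), Nat.mul_div_cancel_left _ hp.pos, key e hem]
    have hRe : R = ∏ q ∈ m.primeFactors.erase p,
        Nat.choose (padicValNat q m) (padicValNat q e) := by
      apply Finset.prod_congr rfl
      intro q hq
      have hqp : q.Prime := (Nat.mem_primeFactors.1 (Finset.mem_erase.1 hq).2).1
      haveI : Fact q.Prime := ⟨hqp⟩
      rw [padicValNat.mul hp0 he0, padicValNat_primes (Finset.mem_erase.1 hq).1, zero_add]
    rw [← hRe, padicValNat.mul hp0 he0, padicValNat_self, add_comm 1, Nat.choose_succ_succ]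
    ring
  · rw [if_neg hpd, padicValNat.eq_zero_of_not_dvd hpd]
    simp

theorem aux_pascal (p m : ℕ) (hp : p.Prime) (hm : 0 < m) (F : ℕ → ℝ) :
    ∑ d ∈ (p * m).divisors, (fChoose (p * m) d : ℝ) * F d =
      ∑ d ∈ m.divisors, (fChoose m d : ℝ) * F d +
      ∑ d ∈ m.divisors, (fChoose m d : ℝ) * F (p * d) := by
  have hpm0 : p * m ≠ 0 := mul_ne_zero hp.ne_zero hm.ne'
  have h : ∀ d ∈ (p * m).divisors, (fChoose (p * m) d : ℝ) * F d =
      (if d ∣ m then (fChoose m d : ℝ) * F d else 0) +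
      (if p ∣ d then (fChoose m (d / p) : ℝ) * F d else 0) := by
    intro d hd
    rw [aux_pointwise p m d hp hm (Nat.dvd_of_mem_divisors hd)]
    split_ifs <;> push_cast <;> ring
  rw [Finset.sum_congr rfl h, Finset.sum_add_distrib, ← Finset.sum_filter, ← Finset.sum_filter]
  congr 1
  · apply Finset.sum_congr _ (fun _ _ => rfl)
    ext d
    simp only [Finset.mem_filter, Nat.mem_divisors]
    constructor
    · rintro ⟨_, h⟩; exact ⟨h, hm.ne'⟩
    · rintro ⟨h, _⟩; exact ⟨⟨h.mul_left p, hpm0⟩, h⟩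
  · symm
    apply Finset.sum_nbij' (fun d => p * d) (fun d => d / p)
    · intro d hd
      simp only [Finset.mem_filter, Nat.mem_divisors] at *
      exact ⟨⟨mul_dvd_mul_left p hd.1, hpm0⟩, dvd_mul_right _ _⟩
    · intro d hd
      simp only [Finset.mem_filter, Nat.mem_divisors] at *
      obtain ⟨⟨h1, _⟩, e, rfl⟩ := hd
      rw [Nat.mul_div_cancel_left _ hp.pos]
      exact ⟨Nat.dvd_of_mul_dvd_mul_left hp.pos h1, hm.ne'⟩
    · intro d _
      exact Nat.mul_div_cancel_left _ hp.pos
    · intro d hd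
      simp only [Finset.mem_filter] at hd
      exact Nat.mul_div_cancel' hd.2
    · intro d _
      rw [Nat.mul_div_cancel_left _ hp.pos]

theorem aux_transfer {ι : Type} [DecidableEq ι] (g : ι → ℕ) (hg : ∀ i, (g i).Prime)
    (S : Finset ι) : ∀ F : ℕ → ℝ,
    ∑ d ∈ (∏ i ∈ S, g i).divisors, (fChoose (∏ i ∈ S, g i) d : ℝ) * F d =
      ∑ T ∈ S.powerset, F (∏ i ∈ T, g i) := by
  induction S using Finset.induction_on with
  | empty => intro F; simp [fChoose]
  | insert a S ha ih =>
    intro F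
    rw [Finset.prod_insert ha, aux_pascal _ _ (hg a) (Finset.prod_pos fun i _ => (hg i).pos),
      Finset.sum_powerset_insert ha, ih F, ih (fun d => F (g a * d))]
    congr 1
    apply Finset.sum_congr rfl
    intro T hT
    rw [Finset.prod_insert (fun h => ha (Finset.mem_powerset.1 hT h))]

theorem aux_diff {ι : Type} [DecidableEq ι] (x : ι → ℝ) (S : Finset ι) :
    ∀ (k : ℕ) (y : ℝ), k < S.card →
      ∑ T ∈ S.powerset, (-1 : ℝ) ^ T.card * (y + ∑ i ∈ T, x i) ^ k = 0 := by
  induction S using Finset.induction_on with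
  | empty => intro k y h; simp at h
  | insert a S ha ih =>
    intro k y hk
    rw [Finset.card_insert_of_notMem ha] at hk
    have h : ∀ T ∈ S.powerset,
        (-1 : ℝ) ^ (insert a T).card * (y + ∑ i ∈ insert a T, x i) ^ k =
        - ((-1 : ℝ) ^ T.card * (y + ∑ i ∈ T, x i) ^ k) -
        ∑ j ∈ Finset.range k, (x a ^ (k - j) * (k.choose j : ℝ)) *
          ((-1 : ℝ) ^ T.card * (y + ∑ i ∈ T, x i) ^ j) := by
      intro T hT
      have haT : a ∉ T := fun h => ha (Finset.mem_powerset.1 hT h)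
      rw [Finset.card_insert_of_notMem haT, Finset.sum_insert haT,
        show y + (x a + ∑ i ∈ T, x i) = (y + ∑ i ∈ T, x i) + x a by ring, add_pow,
        Finset.sum_range_succ, mul_add, Finset.mul_sum]
      simp only [Nat.choose_self, Nat.sub_self, pow_zero, Nat.cast_one, mul_one, pow_succ]
      rw [sub_eq_add_neg, ← Finset.sum_neg_distrib, add_comm]
      congr 1
      · ring
      · apply Finset.sum_congr rfl
        intro j _
        ring
    rw [Finset.sum_powerset_insert ha, Finset.sum_congr rfl h, Finset.sum_sub_distrib,
      Finset.sum_neg_distrib, Finset.sum_comm]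
    have h0 : ∑ j ∈ Finset.range k, ∑ T ∈ S.powerset, (x a ^ (k - j) * (k.choose j : ℝ)) *
          ((-1 : ℝ) ^ T.card * (y + ∑ i ∈ T, x i) ^ j) = 0 := by
      apply Finset.sum_eq_zero
      intro j hj
      rw [← Finset.mul_sum, ih j y (by have := Finset.mem_range.1 hj; omega), mul_zero]
    rw [h0]
    ring

/-- The set version of the Abel factor. -/
noncomputable def auxB {ι : Type} (x : ι → ℝ) (β : ℝ) (U : Finset ι) : ℝ :=
  if U.card = 0 then 1 else β * (β + ∑ i ∈ U, x i) ^ (U.card - 1)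

theorem aux_hurwitz {ι : Type} [DecidableEq ι] (x : ι → ℝ) (β : ℝ) (S : Finset ι) :
    ∀ φ : ℝ, (φ + β + ∑ i ∈ S, x i) ^ S.card =
      ∑ T ∈ S.powerset, (φ + ∑ i ∈ T, x i) ^ T.card * auxB x β (S \ T) := by
  induction S using Finset.strongInduction with
  | H S ih =>
  rcases S.eq_empty_or_nonempty with rfl | hS
  · intro φ; simp [auxB]
  have hc : 0 < S.card := hS.card_pos
  -- the two derivatives agree
  have hder : ∀ φ : ℝ, (S.card : ℝ) * (φ + β + ∑ i ∈ S, x i) ^ (S.card - 1) =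
      ∑ T ∈ S.powerset, (T.card : ℝ) * (φ + ∑ i ∈ T, x i) ^ (T.card - 1) *
        auxB x β (S \ T) := by
    intro φ
    have e1 : (S.card : ℝ) * (φ + β + ∑ i ∈ S, x i) ^ (S.card - 1) =
        ∑ i ∈ S, ∑ T ∈ (S.erase i).powerset,
          (φ + x i + ∑ j ∈ T, x j) ^ T.card * auxB x β (S.erase i \ T) := by
      rw [← nsmul_eq_mul, ← Finset.sum_const]
      apply Finset.sum_congr rfl
      intro i hi
      rw [← ih _ (Finset.erase_ssubset hi), Finset.card_erase_of_mem hi,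
        ← Finset.add_sum_erase S x hi]
      congr 1
      ring
    have e2 : ∑ T ∈ S.powerset, (T.card : ℝ) * (φ + ∑ i ∈ T, x i) ^ (T.card - 1) *
        auxB x β (S \ T) = ∑ T ∈ S.powerset, ∑ i ∈ T, (φ + ∑ i ∈ T, x i) ^ (T.card - 1) *
        auxB x β (S \ T) := by
      apply Finset.sum_congr rfl
      intro T _
      rw [Finset.sum_const, nsmul_eq_mul, mul_assoc]
    rw [e1, e2, Finset.sum_comm' (t' := S) (s' := fun i => S.powerset.filter (fun T => i ∈ T))
      (by
        intro T i
        simp only [Finset.mem_filter, Finset.mem_powerset]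
        constructor
        · rintro ⟨h1, h2⟩; exact ⟨⟨h1, h2⟩, h1 h2⟩
        · rintro ⟨h1, h2⟩; exact h1)]
    apply Finset.sum_congr rfl
    intro i hi
    apply Finset.sum_nbij' (fun T => insert i T) (fun T => T.erase i)
    · intro T hT
      simp only [Finset.mem_filter, Finset.mem_powerset] at *
      exact ⟨Finset.insert_subset hi (hT.trans (Finset.erase_subset _ _)),
        Finset.mem_insert_self _ _⟩
    · intro T hT
      simp only [Finset.mem_filter, Finset.mem_powerset] at *
      exact Finset.erase_subset_erase _ hT.1
    · intro T hT
      exact Finset.erase_insert (fun h => by simpa using Finset.mem_powerset.1 hT h)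
    · intro T hT
      exact Finset.insert_erase (Finset.mem_filter.1 hT).2
    · intro T hT
      have hiT : i ∉ T := fun h => by simpa using Finset.mem_powerset.1 hT h
      have hs : S.erase i \ T = S \ insert i T := by
        ext j; simp; tauto
      rw [Finset.card_insert_of_notMem hiT, Finset.sum_insert hiT, hs, Nat.add_sub_cancel,
        add_assoc]
  have hd : ∀ φ : ℝ, HasDerivAt (fun φ : ℝ => (φ + β + ∑ i ∈ S, x i) ^ S.card -
      ∑ T ∈ S.powerset, (φ + ∑ i ∈ T, x i) ^ T.card * auxB x β (S \ T)) 0 φ := by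
    intro φ
    have a1 : HasDerivAt (fun φ : ℝ => (φ + β + ∑ i ∈ S, x i) ^ S.card)
        ((S.card : ℝ) * (φ + β + ∑ i ∈ S, x i) ^ (S.card - 1) * 1) φ :=
      (((hasDerivAt_id' φ).add_const β).add_const (∑ i ∈ S, x i)).fun_pow S.card
    have a2 : HasDerivAt (fun φ : ℝ =>
        ∑ T ∈ S.powerset, (φ + ∑ i ∈ T, x i) ^ T.card * auxB x β (S \ T))
        (∑ T ∈ S.powerset, (T.card : ℝ) * (φ + ∑ i ∈ T, x i) ^ (T.card - 1) * 1 *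
        auxB x β (S \ T)) φ := by
      apply HasDerivAt.fun_sum
      intro T _
      exact (((hasDerivAt_id' φ).add_const (∑ i ∈ T, x i)).fun_pow T.card).mul_const _
    have a3 := a1.sub a2
    simp only [mul_one] at a3
    rw [← hder φ, sub_self] at a3
    exact a3
  intro φ
  have hconst := is_const_of_deriv_eq_zero (fun t => (hd t).differentiableAt)
    (fun t => (hd t).deriv) φ (-β - ∑ i ∈ S, x i)
  have hz : ∑ T ∈ S.powerset, (-β - ∑ i ∈ S, x i + ∑ i ∈ T, x i) ^ T.card *
      auxB x β (S \ T) = 0 := by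
    have hx := aux_diff x S (S.card - 1) (-β - ∑ i ∈ S, x i) (by omega)
    have : ∀ T ∈ S.powerset, (-β - ∑ i ∈ S, x i + ∑ i ∈ T, x i) ^ T.card *
        auxB x β (S \ T) = (β * (-1) ^ (S.card - 1)) * ((-1 : ℝ) ^ T.card *
          (-β - ∑ i ∈ S, x i + ∑ i ∈ T, x i) ^ (S.card - 1)) := by
      intro T hT
      have hTS := Finset.mem_powerset.1 hT
      have hsum := Finset.sum_sdiff (f := x) hTS
      have hcd := Finset.card_sdiff_add_card_eq_card hTS
      set z := β + ∑ i ∈ S \ T, x i with hzdef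
      have hw : -β - ∑ i ∈ S, x i + ∑ i ∈ T, x i = -z := by rw [hzdef, ← hsum]; ring
      rw [hw, neg_pow z, neg_pow z (S.card - 1)]
      have hsq : (-1 : ℝ) ^ (S.card - 1) * (-1 : ℝ) ^ (S.card - 1) = 1 := by
        rw [← mul_pow]; simp
      have hB : z ^ T.card * auxB x β (S \ T) = β * z ^ (S.card - 1) := by
        unfold auxB
        split_ifs with h0
        · have hz : z = β := by
            rw [hzdef, Finset.card_eq_zero.1 h0]; simp
          rw [hz, mul_one, mul_comm, ← pow_succ]
          congr 1
          omega
        · rw [← hzdef, mul_left_comm, ← pow_add]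
          congr 2
          omega
      linear_combination (-1 : ℝ) ^ T.card * hB - (-1 : ℝ) ^ T.card * β * z ^ (S.card - 1) * hsq
    rw [Finset.sum_congr rfl this, ← Finset.mul_sum, hx, mul_zero]
  rw [hz, show -β - ∑ i ∈ S, x i + β + ∑ i ∈ S, x i = 0 by ring, zero_pow hc.ne', sub_zero] at hconst
  linarith

/-- Second Abel-type identity:
`(φ+β+ln n)^{Ω(n)} = ∑_{d∣n} (n choose d)_f · (φ+ln d)^{Ω(d)} · A(β, n/d)`. -/
theorem abel_second_identity (n : ℕ) (hn : 0 < n) (φ β : ℝ) :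
    (φ + β + Real.log n) ^ (cardFactors n) =
      ∑ d ∈ n.divisors,
        (fChoose n d : ℝ) * (φ + Real.log d) ^ (cardFactors d) * abelFactor β (n / d) := by
  classical
  set l := n.primeFactorsList with hl
  let g : Fin l.length → ℕ := fun i => l[i]
  have hg : ∀ i, (g i).Prime := fun i => Nat.prime_of_mem_primeFactorsList (List.getElem_mem _)
  have hprod : ∏ i, g i = n := by
    have : ∏ i, g i = l.prod := by simp [g]
    rw [this, hl, Nat.prod_primeFactorsList hn.ne']
  have hcard : ∀ T : Finset (Fin l.length), cardFactors (∏ i ∈ T, g i) = T.card := by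
    intro T
    induction T using Finset.induction_on with
    | empty => simp
    | insert a T ha ih =>
      rw [Finset.prod_insert ha, cardFactors_mul (hg a).ne_zero
        (Finset.prod_ne_zero_iff.2 fun i _ => (hg i).ne_zero), ih,
        cardFactors_apply_prime (hg a), Finset.card_insert_of_notMem ha, add_comm]
  have hlog : ∀ T : Finset (Fin l.length), Real.log ((∏ i ∈ T, g i : ℕ) : ℝ) =
      ∑ i ∈ T, Real.log (g i) := by
    intro T
    rw [Nat.cast_prod, Real.log_prod]
    intro i _
    exact_mod_cast (hg i).ne_zero
  have key := aux_hurwitz (fun i => Real.log (g i)) β Finset.univ φ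
  have tr := aux_transfer g hg Finset.univ
    (fun d => (φ + Real.log d) ^ (cardFactors d) * abelFactor β (n / d))
  simp only [hprod] at tr
  simp only [mul_assoc]
  rw [tr]
  have h1 := hcard Finset.univ
  have h2 := hlog Finset.univ
  rw [hprod] at h1 h2
  rw [h1, h2, key]
  apply Finset.sum_congr rfl
  intro T _
  have hdiv : n / (∏ i ∈ T, g i) = ∏ i ∈ Finset.univ \ T, g i := by
    apply Nat.div_eq_of_eq_mul_left (Finset.prod_pos fun i _ => (hg i).pos)
    rw [Finset.prod_sdiff (Finset.subset_univ T), hprod]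
  have hone : (∏ i ∈ Finset.univ \ T, g i = 1) ↔ (Finset.univ \ T).card = 0 := by
    rw [← hcard, cardFactors_eq_zero_iff_eq_zero_or_one]
    constructor
    · exact Or.inr
    · rintro (h | h)
      · exact absurd h (Finset.prod_ne_zero_iff.2 fun i _ => (hg i).ne_zero)
      · exact h
  rw [hdiv, hcard, hlog]
  congr 1
  unfold auxB abelFactor
  rw [hcard, hlog]
  simp only [hone]
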